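/- arXiv:2409.10474 — 2 statements merged into one kernel-verified Lean document; each statement's English description precedes it below -/
import Mathlib

section
/- Let φ : S₁ → S₂ be a unital linear map between local operator systems. Then φ is local completely isometric if and only if φ is a local isometry and both φ and φ⁻¹ : φ(S₁) → S₁ are admissible local completely positive maps. -/
open scoped ComplexOrder

/-- A C*-seminorm on a complex *-algebra. -/
structure IsCstarSeminorm {A : Type*} [Ring A] [StarRing A] [Algebra ℂ A] (p : A → ℝ) : Prop where
  nonneg : ∀ a, 0 ≤ p a
  map_zero' : p 0 = 0
  add_le : ∀ a b, p (a + b) ≤ p a + p b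
  smul : ∀ (c : ℂ) (a : A), p (c • a) = ‖c‖ * p a
  mul_le : ∀ a b, p (a * b) ≤ p a * p b
  star_eq : ∀ a, p (star a) = p a
  cstar : ∀ a, p (star a * a) = p a ^ 2

/-- The family of canonical C*-seminorms on the matrix algebras `Mₙ(A)` induced by a
C*-seminorm `p` on `A`. -/
structure IsMatrixCstarSeminormFamily {A : Type*} [Ring A] [StarRing A] [Algebra ℂ A]
    (p : A → ℝ) (pn : ∀ n : ℕ, Matrix (Fin n) (Fin n) A → ℝ) : Prop where
  cstar : ∀ n, IsCstarSeminorm (pn n)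
  ker : ∀ n (M : Matrix (Fin n) (Fin n) A), pn n M = 0 ↔ ∀ i j, p (M i j) = 0
  one : ∀ a : A, pn 1 (fun _ _ => a) = p a

/-- `λ`-positivity of a matrix over `A` relative to the matrix seminorm `pn` (at level `λ`):
`M = b*b + c` with `pn c = 0`. -/
def LamPos {A : Type*} [Ring A] [StarRing A]
    (pn : ∀ n : ℕ, Matrix (Fin n) (Fin n) A → ℝ) (n : ℕ)
    (M : Matrix (Fin n) (Fin n) A) : Prop :=
  ∃ x c : Matrix (Fin n) (Fin n) A, pn n c = 0 ∧ M = star x * x + c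

/-- Positivity of a matrix of bounded operators, i.e. positivity in `B(H^{⊕n}) ≅ Mₙ(B(H))`. -/
def MatPosOp {H : Type*} [NormedAddCommGroup H] [InnerProductSpace ℂ H] [CompleteSpace H]
    {n : ℕ} (T : Matrix (Fin n) (Fin n) (H →L[ℂ] H)) : Prop :=
  ∃ X : Matrix (Fin n) (Fin n) (H →L[ℂ] H), T = star X * X

/-- The bounded operator on `H^{⊕n}` (with the `ℓ²`-Hilbert space structure) induced by an
`n × n` matrix of bounded operators on `H`. -/
noncomputable def matOp {H : Type*} [NormedAddCommGroup H] [InnerProductSpace ℂ H]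
    {n : ℕ} (T : Matrix (Fin n) (Fin n) (H →L[ℂ] H)) :
    PiLp 2 (fun _ : Fin n => H) →L[ℂ] PiLp 2 (fun _ : Fin n => H) :=
  ((PiLp.continuousLinearEquiv 2 ℂ (fun _ : Fin n => H)).symm :
      ((_ : Fin n) → H) →L[ℂ] PiLp 2 (fun _ : Fin n => H)) ∘L
    (ContinuousLinearMap.pi fun i => ∑ j, (T i j) ∘L (ContinuousLinearMap.proj j)) ∘L
    ((PiLp.continuousLinearEquiv 2 ℂ (fun _ : Fin n => H)) :
      PiLp 2 (fun _ : Fin n => H) →L[ℂ] ((_ : Fin n) → H))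

/-- A map into `B(H)` has trivial commutant (irreducibility). -/
def HasTrivialCommutant {R H : Type*} [NormedAddCommGroup H] [InnerProductSpace ℂ H]
    (φ : R → (H →L[ℂ] H)) : Prop :=
  ∀ T : H →L[ℂ] H, (∀ a, T * φ a = φ a * T) → ∃ c : ℂ, T = c • (1 : H →L[ℂ] H)

/-- Complete positivity at level `λ` for a linear map defined on all of `A`, with values in
`B(H)`: `λ`-positive matrices go to positive operator matrices, and matrices annihilated by the
`λ`-th matrix seminorm go to zero. -/
def IsLamCPmap {A H : Type*} [Ring A] [StarRing A] [Algebra ℂ A]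
    [NormedAddCommGroup H] [InnerProductSpace ℂ H] [CompleteSpace H]
    (pn : ∀ n : ℕ, Matrix (Fin n) (Fin n) A → ℝ) (φ : A →ₗ[ℂ] (H →L[ℂ] H)) : Prop :=
  (∀ (n : ℕ) (M : Matrix (Fin n) (Fin n) A), LamPos pn n M → MatPosOp (M.map φ)) ∧
  (∀ (n : ℕ) (M : Matrix (Fin n) (Fin n) A), pn n M = 0 → M.map φ = 0)

/-- Complete positivity at level `λ` for a linear map defined on a local operator system
`S ⊆ A`, with values in `B(H)`. -/
def IsLamCPmapOn {A H : Type*} [Ring A] [StarRing A] [Algebra ℂ A]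
    [NormedAddCommGroup H] [InnerProductSpace ℂ H] [CompleteSpace H]
    (pn : ∀ n : ℕ, Matrix (Fin n) (Fin n) A → ℝ) (S : Submodule ℂ A)
    (φ : ↥S →ₗ[ℂ] (H →L[ℂ] H)) : Prop :=
  (∀ (n : ℕ) (M : Matrix (Fin n) (Fin n) ↥S), LamPos pn n (M.map Subtype.val) →
      MatPosOp (M.map fun s => φ s)) ∧
  (∀ (n : ℕ) (M : Matrix (Fin n) (Fin n) ↥S), pn n (M.map Subtype.val) = 0 →
      M.map (fun s => φ s) = 0)

/-- Complete positivity (in the C*-algebraic, purely algebraic sense) of a linear map from a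
ring with involution to `B(H)`: matrices of the form `x*x` are sent to positive operator
matrices. For a C*-algebra this is the usual notion of complete positivity. -/
def IsCstarCPmap {R H : Type*} [Ring R] [StarRing R] [Algebra ℂ R]
    [NormedAddCommGroup H] [InnerProductSpace ℂ H] [CompleteSpace H]
    (φ : R →ₗ[ℂ] (H →L[ℂ] H)) : Prop :=
  ∀ (n : ℕ) (M : Matrix (Fin n) (Fin n) R),
    (∃ x : Matrix (Fin n) (Fin n) R, M = star x * x) → MatPosOp (M.map φ)

/-- A boundary representation (in the sense of Arveson) of a C*-algebra `R` for the operator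
system `T ⊆ R`: an irreducible representation which is the unique unital completely positive
extension of its restriction to `T`. -/
def IsBoundaryRep {R H : Type*} [Ring R] [StarRing R] [Algebra ℂ R]
    [NormedAddCommGroup H] [InnerProductSpace ℂ H] [CompleteSpace H]
    (T : Set R) (ψ : R →⋆ₐ[ℂ] (H →L[ℂ] H)) : Prop :=
  HasTrivialCommutant ⇑ψ ∧
  ∀ χ : R →ₗ[ℂ] (H →L[ℂ] H), χ 1 = 1 → IsCstarCPmap χ → (∀ t ∈ T, χ t = ψ t) →
    ∀ b, χ b = ψ b

/-- An admissible local boundary representation of the locally C*-algebra `A` for the local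
operator system `S ⊆ A`. -/
def IsAdmLocBdryRep {Λ A H : Type*} [Ring A] [StarRing A] [Algebra ℂ A]
    [NormedAddCommGroup H] [InnerProductSpace ℂ H] [CompleteSpace H]
    (p : Λ → A → ℝ) (pn : Λ → ∀ n : ℕ, Matrix (Fin n) (Fin n) A → ℝ)
    (S : Submodule ℂ A) (π : A →⋆ₐ[ℂ] (H →L[ℂ] H)) : Prop :=
  HasTrivialCommutant ⇑π ∧
  ∃ l₀ : Λ, (∀ a, ‖π a‖ ≤ p l₀ a) ∧
    ∀ φ : A →ₗ[ℂ] (H →L[ℂ] H), φ 1 = 1 → (∃ l, IsLamCPmap (pn l) φ) →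
      (∀ a, ‖φ a‖ ≤ p l₀ a) → (∀ s ∈ S, φ s = π s) → ∀ a, φ a = π a

/-- An admissible local completely positive map between local operator systems
`S₁ ⊆ A₁` and `S₂ ⊆ A₂` (same index set `Λ` of seminorms). -/
def IsAdmLocCP {Λ A₁ A₂ : Type*} [Ring A₁] [StarRing A₁] [Algebra ℂ A₁]
    [Ring A₂] [StarRing A₂] [Algebra ℂ A₂]
    (pn₁ : Λ → ∀ n : ℕ, Matrix (Fin n) (Fin n) A₁ → ℝ)
    (pn₂ : Λ → ∀ n : ℕ, Matrix (Fin n) (Fin n) A₂ → ℝ)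
    (S₁ : Submodule ℂ A₁) (S₂ : Submodule ℂ A₂) (φ : ↥S₁ →ₗ[ℂ] ↥S₂) : Prop :=
  ∀ (l : Λ) (n : ℕ) (M : Matrix (Fin n) (Fin n) ↥S₁),
    (LamPos (pn₁ l) n (M.map Subtype.val) →
      LamPos (pn₂ l) n (M.map fun s => ((φ s : ↥S₂) : A₂))) ∧
    (pn₁ l n (M.map Subtype.val) = 0 → pn₂ l n (M.map fun s => ((φ s : ↥S₂) : A₂)) = 0)

/-- A local completely isometric map between local operator systems. -/
def IsLocCompIsometric {Λ A₁ A₂ : Type*} [Ring A₁] [StarRing A₁] [Algebra ℂ A₁]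
    [Ring A₂] [StarRing A₂] [Algebra ℂ A₂]
    (pn₁ : Λ → ∀ n : ℕ, Matrix (Fin n) (Fin n) A₁ → ℝ)
    (pn₂ : Λ → ∀ n : ℕ, Matrix (Fin n) (Fin n) A₂ → ℝ)
    (S₁ : Submodule ℂ A₁) (S₂ : Submodule ℂ A₂) (φ : ↥S₁ →ₗ[ℂ] ↥S₂) : Prop :=
  ∀ (l : Λ) (n : ℕ) (M : Matrix (Fin n) (Fin n) ↥S₁),
    pn₂ l n (M.map fun s => ((φ s : ↥S₂) : A₂)) = pn₁ l n (M.map Subtype.val)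

/-- A completely positive map (algebraic sense) between operator systems `T₁ ⊆ R₁`, `T₂ ⊆ R₂`
sitting in C*-algebras. -/
def IsCstarCPmapOn {R₁ R₂ : Type*} [Ring R₁] [StarRing R₁] [Algebra ℂ R₁]
    [Ring R₂] [StarRing R₂] [Algebra ℂ R₂]
    (T₁ : Submodule ℂ R₁) (T₂ : Submodule ℂ R₂) (ψ : ↥T₁ →ₗ[ℂ] ↥T₂) : Prop :=
  ∀ (n : ℕ) (M : Matrix (Fin n) (Fin n) ↥T₁),
    (∃ x : Matrix (Fin n) (Fin n) R₁, M.map Subtype.val = star x * x) →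
    ∃ y : Matrix (Fin n) (Fin n) R₂, M.map (fun s => ((ψ s : ↥T₂) : R₂)) = star y * y

/-- A local boundary ideal for a local operator system `S ⊆ A`: a closed two-sided *-ideal such
that the quotient map is completely isometric on `S` with respect to the quotient matrix
seminorms. -/
def IsLocBdryIdeal {Λ A : Type*} [Ring A] [StarRing A] [Algebra ℂ A] [TopologicalSpace A]
    (pn : Λ → ∀ n : ℕ, Matrix (Fin n) (Fin n) A → ℝ) (S : Submodule ℂ A)
    (I : Set A) : Prop :=
  (∃ J : TwoSidedIdeal A, (J : Set A) = I) ∧ (∀ a ∈ I, star a ∈ I) ∧ IsClosed I ∧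
  ∀ (l : Λ) (n : ℕ) (M : Matrix (Fin n) (Fin n) ↥S),
    sInf {r : ℝ | ∃ C : Matrix (Fin n) (Fin n) A, (∀ i j, C i j ∈ I) ∧
        r = pn l n (M.map Subtype.val + C)} = pn l n (M.map Subtype.val)


section CStarAlgebra

variable {R : Type*} [CStarAlgebra R]

open scoped ComplexStarModule in
theorem isSelfAdjoint_of_norm_add_smul_one_sq_le {x : R} {C : ℝ}
    (h : ∀ t : ℝ, ‖x + ((t : ℂ) * Complex.I) • (1 : R)‖ ^ 2 ≤ C + t ^ 2) : IsSelfAdjoint x := by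
  obtain _ | _ := subsingleton_or_nontrivial R
  · exact Subsingleton.elim _ _
  set b : R := (ℑ x : R) with hb
  have hbs : IsSelfAdjoint b := (ℑ x).2
  have key : ∀ μ ∈ spectrum ℝ b, μ = 0 := by
    intro μ hμ
    have h1 : ∀ t : ℝ, (t + μ) ^ 2 ≤ C + t ^ 2 := by
      intro t
      have hmem : t + μ ∈ spectrum ℝ (algebraMap ℝ R t + b) := by
        rw [add_comm t]
        exact spectrum.add_mem_add_iff.2 hμ
      have hn : ‖t + μ‖ ≤ ‖algebraMap ℝ R t + b‖ := spectrum.norm_le_norm_of_mem hmem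
      have him : algebraMap ℝ R t + b = (ℑ (x + ((t : ℂ) * Complex.I) • (1 : R)) : R) := by
        have h1 : IsSelfAdjoint (1 : R) := IsSelfAdjoint.one R
        rw [map_add, imaginaryPart_smul]
        simp [h1.imaginaryPart, Algebra.algebraMap_eq_smul_one, hb, add_comm]
      have h2 : ‖t + μ‖ ≤ ‖x + ((t : ℂ) * Complex.I) • (1 : R)‖ := by
        refine hn.trans ?_
        rw [him]
        exact imaginaryPart.norm_le (x + ((t : ℂ) * Complex.I) • (1 : R))
      rw [← sq_abs]
      exact (pow_le_pow_left₀ (abs_nonneg _) h2 2).trans (h t)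
    by_contra hne
    have := h1 ((C + 1) / (2 * μ))
    have h3 : (C + 1) / (2 * μ) * μ = (C + 1) / 2 := by field_simp
    nlinarith [sq_nonneg μ]
  have hb0 : b = 0 := by
    rcases CStarAlgebra.norm_or_neg_norm_mem_spectrum hbs with h' | h'
    · exact norm_eq_zero.1 (key _ h')
    · exact norm_eq_zero.1 (neg_eq_zero.1 (key _ h'))
  rw [← realPart_add_I_smul_imaginaryPart x, ← hb, hb0]
  simp

theorem IsSelfAdjoint.norm_add_smul_one_sq_le {x : R} (hx : IsSelfAdjoint x) (t : ℝ) :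
    ‖x + ((t : ℂ) * Complex.I) • (1 : R)‖ ^ 2 ≤ ‖x‖ ^ 2 + t ^ 2 := by
  obtain _ | _ := subsingleton_or_nontrivial R
  · simp [Subsingleton.elim (x + ((t : ℂ) * Complex.I) • (1 : R)) 0]; positivity
  rw [sq, ← CStarRing.norm_star_mul_self]
  have : star (x + ((t : ℂ) * Complex.I) • (1 : R)) * (x + ((t : ℂ) * Complex.I) • (1 : R))
      = x * x + ((t ^ 2 : ℝ) : ℂ) • (1 : R) := by
    simp only [star_add, hx.star_eq, star_smul, star_one, add_mul, mul_add, smul_mul_assoc,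
      mul_smul_comm, one_mul, mul_one, smul_smul, smul_add]
    have h1 : star ((t : ℂ) * Complex.I) = -((t : ℂ) * Complex.I) := by simp
    have h2 : (t : ℂ) * Complex.I * (-((t : ℂ) * Complex.I)) = ((t ^ 2 : ℝ) : ℂ) := by
      push_cast; linear_combination (-(t : ℂ) ^ 2) * Complex.I_sq
    rw [h1, ← h2, mul_comm]
    module
  rw [this]
  refine (norm_add_le _ _).trans ?_
  rw [norm_smul, norm_one, mul_one, Complex.norm_real, Real.norm_of_nonneg (sq_nonneg t), sq ‖x‖]
  gcongr
  exact norm_mul_le _ _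

variable {R₁ R₂ E : Type*} [CStarAlgebra R₁] [PartialOrder R₁] [StarOrderedRing R₁]
  [CStarAlgebra R₂] [PartialOrder R₂] [StarOrderedRing R₂] [AddCommGroup E] [Module ℂ E]

theorem nonneg_of_norm_eq_of_unital (α : E →ₗ[ℂ] R₁) (β : E →ₗ[ℂ] R₂) {e : E}
    (hα : α e = 1) (hβ : β e = 1) (h : ∀ x, ‖β x‖ = ‖α x‖) {x : E} (hx : 0 ≤ α x) :
    0 ≤ β x := by
  have hsa : IsSelfAdjoint (β x) := by
    refine isSelfAdjoint_of_norm_add_smul_one_sq_le (C := ‖α x‖ ^ 2) fun t => ?_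
    have := hx.isSelfAdjoint.norm_add_smul_one_sq_le t
    rwa [← hα, ← map_smul, ← map_add, ← h, map_add, map_smul, hβ] at this
  set r := ‖α x‖ with hr
  have h1 : ‖(r : ℂ) • (1 : R₁) - α x‖ ≤ r := by
    have hle : α x ≤ algebraMap ℝ R₁ r := hx.isSelfAdjoint.le_algebraMap_norm_self
    have heq : (r : ℂ) • (1 : R₁) = algebraMap ℝ R₁ r := by
      rw [Algebra.algebraMap_eq_smul_one, Complex.coe_smul]
    rw [heq, CStarAlgebra.norm_le_iff_le_algebraMap _ (norm_nonneg _) (sub_nonneg.2 hle)]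
    exact sub_le_self _ hx
  rw [← hα, ← map_smul, ← map_sub, ← h, map_sub, map_smul, hβ] at h1
  have heq : (r : ℂ) • (1 : R₂) = algebraMap ℝ R₂ r := by
    rw [Algebra.algebraMap_eq_smul_one, Complex.coe_smul]
  rw [heq] at h1
  have hs : IsSelfAdjoint (algebraMap ℝ R₂ r - β x) :=
    ((IsSelfAdjoint.all r).algebraMap R₂).sub hsa
  have h2 : algebraMap ℝ R₂ r - β x ≤ algebraMap ℝ R₂ r :=
    hs.le_algebraMap_norm_self.trans (algebraMap_mono _ h1)
  simpa using h2

/-- A C*-seminorm on a C*-algebra is dominated by the norm. -/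
theorem IsCstarSeminorm.le_norm {q : R → ℝ} (hq : IsCstarSeminorm q) (a : R) : q a ≤ ‖a‖ := by
  let _ := CStarAlgebra.spectralOrder R
  have _ := CStarAlgebra.spectralOrderedRing R
  have h1 : q 1 ≤ 1 := by
    have := hq.cstar 1
    rw [star_one, one_mul] at this
    nlinarith [hq.nonneg 1]
  have hu : ∀ u ∈ unitary R, q u ≤ 1 := by
    intro u hu
    have := hq.cstar u
    rw [Unitary.star_mul_self_of_mem hu] at this
    nlinarith [hq.nonneg u]
  have hball : ∀ b : R, IsSelfAdjoint b → ‖b‖ ≤ 1 → q b ≤ 1 := by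
    intro b hb hb1
    have hm := hb.self_add_I_smul_cfcSqrt_sub_sq_mem_unitary b hb1
    set u := b + Complex.I • CFC.sqrt (1 - b ^ 2) with hu'
    have hst : star u = b - Complex.I • CFC.sqrt (1 - b ^ 2) := by
      simp [hu', hb.star_eq, ← sub_eq_add_neg,
        (CFC.sqrt_nonneg (1 - b ^ 2 : R)).isSelfAdjoint.star_eq]
    have hbe : b = (2⁻¹ : ℂ) • (u + star u) := by
      rw [hst, hu']; module
    have h2 := hq.smul 2⁻¹ (u + star u)
    rw [← hbe] at h2
    have h3 := hq.add_le u (star u)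
    rw [hq.star_eq] at h3
    have h4 := hu u hm
    norm_num at h2
    linarith
  have hsa : ∀ b : R, IsSelfAdjoint b → q b ≤ ‖b‖ := by
    intro b hb
    obtain rfl | hb0 := eq_or_ne b 0
    · simp [hq.map_zero']
    have hn : 0 < ‖b‖ := norm_pos_iff.2 hb0
    have h2 := hball (((‖b‖⁻¹ : ℝ) : ℂ) • b) (by
        rw [Complex.coe_smul]; exact (IsSelfAdjoint.all _).smul hb) (by
        rw [norm_smul, Complex.norm_real, norm_inv, norm_norm, inv_mul_cancel₀ hn.ne'])
    rw [hq.smul, Complex.norm_real, norm_inv, norm_norm, inv_mul_le_iff₀ hn, mul_one] at h2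
    exact h2
  have := hsa (star a * a) (IsSelfAdjoint.star_mul_self a)
  rw [hq.cstar, CStarRing.norm_star_mul_self, ← sq] at this
  exact (sq_le_sq₀ (hq.nonneg _) (norm_nonneg _)).1 this

/-- A faithful C*-seminorm on a C*-algebra is the norm. -/
theorem IsCstarSeminorm.eq_norm {q : R → ℝ} (hq : IsCstarSeminorm q)
    (h0 : ∀ a, q a = 0 → a = 0) (a : R) : q a = ‖a‖ := by
  let _ := CStarAlgebra.spectralOrder R
  have _ := CStarAlgebra.spectralOrderedRing R
  obtain _ | _ := subsingleton_or_nontrivial R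
  · simp [Subsingleton.elim a 0, hq.map_zero']
  have hpos : ∀ b : R, 0 ≤ b → ‖b‖ ≤ q b := by
    intro b hb
    by_contra! hlt
    obtain ⟨s, hs1, hs2⟩ := exists_between hlt
    have hs0 : 0 < s := (hq.nonneg b).trans_lt hs1
    have hbs : IsSelfAdjoint b := hb.isSelfAdjoint
    let f : ℝ → ℝ := fun t => max (t - s) 0
    let g : ℝ → ℝ := fun t => (max t s)⁻¹
    have hf : Continuous f := by fun_prop
    have hgc : Continuous g := by
      refine Continuous.inv₀ (by fun_prop) fun t => ?_
      exact (hs0.trans_le (le_max_right _ _)).ne'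
    have hfg : cfc f b = cfc f b * (b * cfc g b) := by
      have h1 : b * cfc g b = cfc (fun t => t * g t) b := by
        rw [cfc_mul (fun t => t) g b (by fun_prop) hgc.continuousOn, cfc_id' ℝ b]
      rw [h1, ← cfc_mul f (fun t => t * g t) b hf.continuousOn (by fun_prop)]
      refine cfc_congr fun t _ => ?_
      simp only [f, g]
      rcases le_total t s with h | h
      · simp [h]
      · rw [max_eq_left h, mul_inv_cancel₀ (hs0.trans_le h).ne', mul_one]
    have hgn : q (cfc g b) ≤ s⁻¹ := by
      refine (hq.le_norm _).trans (norm_cfc_le (inv_nonneg.2 hs0.le) fun t _ => ?_)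
      simp only [g]
      rw [Real.norm_of_nonneg (inv_nonneg.2 (hs0.le.trans (le_max_right _ _)))]
      exact inv_anti₀ hs0 (le_max_right _ _)
    have hqf : q (cfc f b) = 0 := by
      have h1 : q (cfc f b) ≤ q (cfc f b) * (q b * s⁻¹) := by
        conv_lhs => rw [hfg]
        refine (hq.mul_le _ _).trans (mul_le_mul_of_nonneg_left ?_ (hq.nonneg _))
        exact (hq.mul_le _ _).trans (mul_le_mul_of_nonneg_left hgn (hq.nonneg _))
      have h2 : q b * s⁻¹ < 1 := by rwa [← div_eq_mul_inv, div_lt_one hs0]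
      nlinarith [hq.nonneg (cfc f b)]
    have hz := h0 _ hqf
    have hmem : f ‖b‖ ∈ spectrum ℝ (cfc f b) := by
      rw [cfc_map_spectrum f b]
      exact ⟨_, CStarAlgebra.norm_mem_spectrum_of_nonneg hb, rfl⟩
    rw [hz, spectrum.zero_eq] at hmem
    have : f ‖b‖ = 0 := hmem
    have h3 : ‖b‖ - s ≤ f ‖b‖ := le_max_left _ _
    linarith
  refine le_antisymm (hq.le_norm a) ?_
  have := hpos (star a * a) (star_mul_self_nonneg a)
  rw [hq.cstar, CStarRing.norm_star_mul_self, ← sq] at this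
  exact (sq_le_sq₀ (norm_nonneg _) (hq.nonneg _)).1 this

theorem IsCstarSeminorm.eq_norm_apply {A : Type*} [Ring A] [StarRing A] [Algebra ℂ A]
    {q : A → ℝ} (hq : IsCstarSeminorm q) (f : A →⋆ₐ[ℂ] R) (hf : Function.Surjective f)
    (h0 : ∀ a, q a = 0 ↔ f a = 0) (a : A) : q a = ‖f a‖ := by
  have hle : ∀ a b, f a = f b → q a ≤ q b := by
    intro a b hab
    have h1 := hq.add_le (a - b) b
    rwa [sub_add_cancel, (h0 (a - b)).2 (by rw [map_sub, hab, sub_self]), zero_add] at h1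
  have hwd : ∀ a b, f a = f b → q a = q b := fun a b hab =>
    le_antisymm (hle a b hab) (hle b a hab.symm)
  let g := Function.surjInv hf
  have hg : ∀ x, f (g x) = x := Function.surjInv_eq hf
  have hq' : IsCstarSeminorm fun x => q (g x) :=
    { nonneg := fun x => hq.nonneg _
      map_zero' := by
        rw [h0, hg]
      add_le := fun x y => by
        rw [hwd (g (x + y)) (g x + g y) (by simp [hg])]; exact hq.add_le _ _
      smul := fun c x => by
        rw [hwd (g (c • x)) (c • g x) (by simp [hg])]; exact hq.smul _ _
      mul_le := fun x y => by
        rw [hwd (g (x * y)) (g x * g y) (by simp [hg])]; exact hq.mul_le _ _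
      star_eq := fun x => by
        rw [hwd (g (star x)) (star (g x)) (by rw [map_star, hg, hg])]; exact hq.star_eq _
      cstar := fun x => by
        rw [hwd (g (star x * x)) (star (g x) * g x) (by rw [map_mul, map_star, hg, hg])]
        exact hq.cstar _ }
  rw [hwd a (g (f a)) (hg _).symm]
  exact hq'.eq_norm (fun x hx => by rw [← hg x]; exact (h0 _).1 hx) (f a)

end CStarAlgebra

section MatrixPositivity

theorem Matrix.star_ofReal_smul {B m : Type*} [Ring B] [StarRing B] [Module ℂ B] [StarModule ℂ B]
    (c : ℝ) (N : Matrix m m B) : star ((c : ℂ) • N) = (c : ℂ) • star N := by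
  rw [star_smul, RCLike.star_def, Complex.conj_ofReal]

theorem Matrix.map_smul_linearMap {B S m : Type*} [AddCommGroup B] [Module ℂ B] [AddCommGroup S]
    [Module ℂ S] (a : S →ₗ[ℂ] B) (c : ℂ) (N : Matrix m m S) : (c • N).map a = c • N.map a :=
  map_smul a.mapMatrix c N

theorem Matrix.map_diagonal_eq_one {B S m : Type*} [DecidableEq m] [Ring B] [Module ℂ B]
    [AddCommGroup S] [Module ℂ S] (a : S →ₗ[ℂ] B) {e : S} (h : a e = 1) :
    (Matrix.diagonal fun _ : m => e).map a = 1 := by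
  rw [Matrix.diagonal_map (map_zero a), ← Matrix.diagonal_one]
  simp [h]

variable {B : Type*} [Ring B] [StarRing B] {m : Type*} [Fintype m] [DecidableEq m]

theorem Matrix.fromBlocks_one_eq_star_mul_self {x z : Matrix m m B}
    (h : 1 - star x * x = star z * z) :
    Matrix.fromBlocks 1 x (star x) 1 =
      star (Matrix.fromBlocks 1 x 0 z) * Matrix.fromBlocks 1 x 0 z := by
  rw [Matrix.star_eq_conjTranspose (Matrix.fromBlocks 1 x 0 z), Matrix.fromBlocks_conjTranspose,
    Matrix.fromBlocks_multiply]
  simp [← Matrix.star_eq_conjTranspose, ← h]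

theorem Matrix.exists_of_fromBlocks_one_eq_star_mul_self {y w : Matrix m m B}
    {Y : Matrix (m ⊕ m) (m ⊕ m) B} (h : Matrix.fromBlocks 1 y w 1 = star Y * Y) :
    w = star y ∧ ∃ C D : Matrix m m B, 1 - star y * y = star C * C + star D * D := by
  rw [← Matrix.fromBlocks_toBlocks Y, Matrix.star_eq_conjTranspose,
    Matrix.fromBlocks_conjTranspose, Matrix.fromBlocks_multiply, Matrix.fromBlocks_inj] at h
  simp only [← Matrix.star_eq_conjTranspose] at h
  obtain ⟨h11, h12, h21, h22⟩ := h
  have hw : w = star y := by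
    rw [h21, h12]
    simp
  refine ⟨hw, Y.toBlocks₁₂ - Y.toBlocks₁₁ * y, Y.toBlocks₂₂ - Y.toBlocks₂₁ * y, ?_⟩
  have e : star (Y.toBlocks₁₂ - Y.toBlocks₁₁ * y) * (Y.toBlocks₁₂ - Y.toBlocks₁₁ * y)
      + star (Y.toBlocks₂₂ - Y.toBlocks₂₁ * y) * (Y.toBlocks₂₂ - Y.toBlocks₂₁ * y)
      = (star Y.toBlocks₁₂ * Y.toBlocks₁₂ + star Y.toBlocks₂₂ * Y.toBlocks₂₂)
        - (star Y.toBlocks₁₂ * Y.toBlocks₁₁ + star Y.toBlocks₂₂ * Y.toBlocks₂₁) * y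
        - star y * (star Y.toBlocks₁₁ * Y.toBlocks₁₂ + star Y.toBlocks₂₁ * Y.toBlocks₂₂)
        + star y * (star Y.toBlocks₁₁ * Y.toBlocks₁₁ + star Y.toBlocks₂₁ * Y.toBlocks₂₁) * y := by
    simp only [star_sub, star_mul]
    noncomm_ring
  rw [e, ← h11, ← h12, ← h21, ← h22, hw]
  noncomm_ring

end MatrixPositivity

section CStarMatrix

variable {B : Type*} [CStarAlgebra B] [PartialOrder B] [StarOrderedRing B]

open CStarMatrix

theorem nonneg_iff_exists_eq_star_mul_self (b : B) : 0 ≤ b ↔ ∃ y, b = star y * y :=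
  CStarAlgebra.nonneg_iff_eq_star_mul_self

theorem CStarMatrix.nonneg_ofMatrix_iff {n : ℕ} (M : Matrix (Fin n) (Fin n) B) :
    0 ≤ ofMatrix M ↔ ∃ Y : Matrix (Fin n) (Fin n) B, M = star Y * Y :=
  nonneg_iff_exists_eq_star_mul_self (ofMatrix M)

theorem CStarMatrix.nonneg_ofMatrix_reindex_iff {m : Type*} [Fintype m] {n : ℕ}
    (e : m ≃ Fin n) (M : Matrix m m B) :
    0 ≤ ofMatrix (Matrix.reindex e e M) ↔ ∃ Y : Matrix m m B, M = star Y * Y := by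
  rw [CStarMatrix.nonneg_ofMatrix_iff]
  constructor
  · rintro ⟨Y, hY⟩
    refine ⟨(Matrix.reindex e e).symm Y, ?_⟩
    rw [← Equiv.eq_symm_apply] at hY
    rw [hY]
    simp [Matrix.star_eq_conjTranspose, Matrix.conjTranspose_submatrix, Matrix.submatrix_mul_equiv]
  · rintro ⟨Y, rfl⟩
    refine ⟨Matrix.reindex e e Y, ?_⟩
    simp [Matrix.star_eq_conjTranspose, Matrix.conjTranspose_submatrix, Matrix.submatrix_mul_equiv]

theorem CStarMatrix.norm_le_one_iff {n : ℕ} (y : Matrix (Fin n) (Fin n) B) :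
    ‖ofMatrix y‖ ≤ 1 ↔ 0 ≤ ofMatrix (1 - star y * y) := by
  have h1 : ofMatrix (1 - star y * y) = 1 - star (ofMatrix y) * ofMatrix y := rfl
  have h2 := CStarAlgebra.norm_le_one_iff_of_nonneg (star (ofMatrix y) * ofMatrix y)
    (star_mul_self_nonneg _)
  rw [h1, sub_nonneg, ← h2, CStarRing.norm_star_mul_self]
  rw [← sq, sq_le_one_iff₀ (norm_nonneg _)]

theorem CStarMatrix.norm_ofMatrix_ofReal_smul {n : ℕ} (M : Matrix (Fin n) (Fin n) B) {c : ℝ}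
    (hc : 0 ≤ c) : ‖ofMatrix ((c : ℂ) • M)‖ = c * ‖ofMatrix M‖ := by
  refine (norm_smul (c : ℂ) (ofMatrix M)).trans ?_
  rw [Complex.norm_real, Real.norm_of_nonneg hc]

variable {B₁ B₂ S : Type*} [CStarAlgebra B₁] [PartialOrder B₁] [StarOrderedRing B₁]
  [CStarAlgebra B₂] [PartialOrder B₂] [StarOrderedRing B₂] [AddCommGroup S] [Module ℂ S]
  {a₁ : S →ₗ[ℂ] B₁} {a₂ : S →ₗ[ℂ] B₂} {e : S}

theorem map_star_and_norm_le_of_completelyPositive_of_norm_le_one (h₁ : a₁ e = 1) (h₂ : a₂ e = 1)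
    (hpos : ∀ (n : ℕ) (M : Matrix (Fin n) (Fin n) S),
      0 ≤ ofMatrix (M.map a₁) → 0 ≤ ofMatrix (M.map a₂))
    {n : ℕ} {M W : Matrix (Fin n) (Fin n) S} (hW : W.map a₁ = star (M.map a₁))
    (hM : ‖ofMatrix (M.map a₁)‖ ≤ 1) :
    W.map a₂ = star (M.map a₂) ∧ ‖ofMatrix (M.map a₂)‖ ≤ 1 := by
  let Z : Matrix (Fin n ⊕ Fin n) (Fin n ⊕ Fin n) S :=
    Matrix.fromBlocks (Matrix.diagonal fun _ => e) M W (Matrix.diagonal fun _ => e)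
  obtain ⟨z, hz⟩ := (CStarMatrix.nonneg_ofMatrix_iff _).1 ((CStarMatrix.norm_le_one_iff _).1 hM)
  have hZ₁ : Z.map a₁ = Matrix.fromBlocks 1 (M.map a₁) (star (M.map a₁)) 1 := by
    rw [Matrix.fromBlocks_map, hW, Matrix.map_diagonal_eq_one a₁ h₁]
  have hZ₂ : Z.map a₂ = Matrix.fromBlocks 1 (M.map a₂) (W.map a₂) 1 := by
    rw [Matrix.fromBlocks_map, Matrix.map_diagonal_eq_one a₂ h₂]
  have hp := hpos (n + n) (Matrix.reindex finSumFinEquiv finSumFinEquiv Z) <|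
    (CStarMatrix.nonneg_ofMatrix_reindex_iff finSumFinEquiv (Z.map a₁)).2
      ⟨_, hZ₁.trans (Matrix.fromBlocks_one_eq_star_mul_self hz)⟩
  obtain ⟨Y, hY⟩ := (CStarMatrix.nonneg_ofMatrix_reindex_iff finSumFinEquiv (Z.map a₂)).1 hp
  obtain ⟨hw, C, D, hCD⟩ :=
    Matrix.exists_of_fromBlocks_one_eq_star_mul_self (hZ₂.symm.trans hY)
  refine ⟨hw, (CStarMatrix.norm_le_one_iff _).2 ?_⟩
  rw [hCD]
  exact add_nonneg (star_mul_self_nonneg (ofMatrix C)) (star_mul_self_nonneg (ofMatrix D))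

theorem map_star_and_norm_le_of_completelyPositive (h₁ : a₁ e = 1) (h₂ : a₂ e = 1)
    (hpos : ∀ (n : ℕ) (M : Matrix (Fin n) (Fin n) S),
      0 ≤ ofMatrix (M.map a₁) → 0 ≤ ofMatrix (M.map a₂))
    {n : ℕ} {M W : Matrix (Fin n) (Fin n) S} (hW : W.map a₁ = star (M.map a₁)) :
    W.map a₂ = star (M.map a₂) ∧ ‖ofMatrix (M.map a₂)‖ ≤ ‖ofMatrix (M.map a₁)‖ := by
  have key : ∀ r : ℝ, ‖ofMatrix (M.map a₁)‖ < r →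
      W.map a₂ = star (M.map a₂) ∧ ‖ofMatrix (M.map a₂)‖ ≤ r := by
    intro r hr
    have hr0 : 0 < r := (norm_nonneg _).trans_lt hr
    have hc : ((r⁻¹ : ℝ) : ℂ) ≠ 0 := by exact_mod_cast (inv_pos.2 hr0).ne'
    obtain ⟨hs, hn⟩ := map_star_and_norm_le_of_completelyPositive_of_norm_le_one h₁ h₂ hpos
      (M := ((r⁻¹ : ℝ) : ℂ) • M) (W := ((r⁻¹ : ℝ) : ℂ) • W)
      (by rw [Matrix.map_smul_linearMap, Matrix.map_smul_linearMap, hW, Matrix.star_ofReal_smul]) (by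
        rw [Matrix.map_smul_linearMap, CStarMatrix.norm_ofMatrix_ofReal_smul _ (inv_nonneg.2 hr0.le),
          inv_mul_le_iff₀ hr0, mul_one]
        exact hr.le)
    rw [Matrix.map_smul_linearMap, Matrix.map_smul_linearMap, Matrix.star_ofReal_smul] at hs
    rw [Matrix.map_smul_linearMap, CStarMatrix.norm_ofMatrix_ofReal_smul _ (inv_nonneg.2 hr0.le),
      inv_mul_le_iff₀ hr0, mul_one] at hn
    exact ⟨smul_right_injective _ hc hs, hn⟩
  exact ⟨(key _ (lt_add_one _)).1, le_of_forall_gt_imp_ge_of_dense fun r hr => (key r hr).2⟩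

/-- A unital correspondence between two concrete images of an operator system is completely
isometric iff it preserves and reflects positivity at all matrix levels. -/
theorem forall_norm_eq_iff_forall_nonneg_iff (h₁ : a₁ e = 1) (h₂ : a₂ e = 1)
    (hstar : ∀ s, ∃ t, a₁ t = star (a₁ s)) :
    (∀ (n : ℕ) (M : Matrix (Fin n) (Fin n) S),
      ‖ofMatrix (M.map a₂)‖ = ‖ofMatrix (M.map a₁)‖) ↔
    ∀ (n : ℕ) (M : Matrix (Fin n) (Fin n) S),
      0 ≤ ofMatrix (M.map a₁) ↔ 0 ≤ ofMatrix (M.map a₂) := by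
  constructor
  · intro h n M
    let α : Matrix (Fin n) (Fin n) S →ₗ[ℂ] CStarMatrix (Fin n) (Fin n) B₁ :=
      (ofMatrixₗ : _ ≃ₗ[ℂ] _).toLinearMap ∘ₗ a₁.mapMatrix
    let β : Matrix (Fin n) (Fin n) S →ₗ[ℂ] CStarMatrix (Fin n) (Fin n) B₂ :=
      (ofMatrixₗ : _ ≃ₗ[ℂ] _).toLinearMap ∘ₗ a₂.mapMatrix
    have hα : α (Matrix.diagonal fun _ => e) = 1 := Matrix.map_diagonal_eq_one a₁ h₁
    have hβ : β (Matrix.diagonal fun _ => e) = 1 := Matrix.map_diagonal_eq_one a₂ h₂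
    exact ⟨fun hM => nonneg_of_norm_eq_of_unital α β hα hβ (h n) (x := M) hM,
      fun hM => nonneg_of_norm_eq_of_unital β α hβ hα (fun x => (h n x).symm) (x := M) hM⟩
  · intro h n M
    choose σ hσ using hstar
    have hW : (Matrix.of fun i j => σ (M j i)).map a₁ = star (M.map a₁) := by
      ext i j
      simp [hσ, Matrix.star_apply]
    obtain ⟨hW', hle⟩ :=
      map_star_and_norm_le_of_completelyPositive h₁ h₂ (fun n M => (h n M).1) hW
    exact le_antisymm hle
      (map_star_and_norm_le_of_completelyPositive h₂ h₁ (fun n M => (h n M).2) hW').2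

end CStarMatrix

section MatrixSeminorm

variable {A B : Type*} [Ring A] [StarRing A] [Algebra ℂ A] [CStarAlgebra B]
  {p : A → ℝ} {pn : ∀ n : ℕ, Matrix (Fin n) (Fin n) A → ℝ}

open CStarMatrix

theorem IsMatrixCstarSeminormFamily.eq_zero_iff (hpn : IsMatrixCstarSeminormFamily p pn)
    {π : A →⋆ₐ[ℂ] B} (hnorm : ∀ a, ‖π a‖ = p a) (n : ℕ) (M : Matrix (Fin n) (Fin n) A) :
    pn n M = 0 ↔ M.map π = 0 := by
  rw [hpn.ker, ← Matrix.ext_iff]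
  simp [← hnorm]

theorem IsMatrixCstarSeminormFamily.eq_norm_ofMatrix [PartialOrder B] [StarOrderedRing B]
    (hpn : IsMatrixCstarSeminormFamily p pn) {π : A →⋆ₐ[ℂ] B} (hsurj : Function.Surjective π)
    (hnorm : ∀ a, ‖π a‖ = p a) (n : ℕ) (M : Matrix (Fin n) (Fin n) A) :
    pn n M = ‖ofMatrix (M.map π)‖ := by
  let f : Matrix (Fin n) (Fin n) A →⋆ₐ[ℂ] CStarMatrix (Fin n) (Fin n) B :=
    { (ofMatrixStarAlgEquiv : Matrix (Fin n) (Fin n) B ≃⋆ₐ[ℂ] _).toStarAlgHom.toAlgHom.comp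
        (AlgHom.mapMatrix (π : A →ₐ[ℂ] B)) with
      map_star' := fun M => Matrix.ext fun i j => map_star π (M j i) }
  refine (hpn.cstar n).eq_norm_apply f (fun N => ?_) (fun M => hpn.eq_zero_iff hnorm n M) M
  exact ⟨(ofMatrix.symm N).map (Function.surjInv hsurj),
    Matrix.ext fun i j => Function.surjInv_eq hsurj _⟩

theorem IsMatrixCstarSeminormFamily.lamPos_iff [PartialOrder B] [StarOrderedRing B]
    (hpn : IsMatrixCstarSeminormFamily p pn) {π : A →⋆ₐ[ℂ] B} (hsurj : Function.Surjective π)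
    (hnorm : ∀ a, ‖π a‖ = p a) (n : ℕ) (M : Matrix (Fin n) (Fin n) A) :
    LamPos pn n M ↔ 0 ≤ ofMatrix (M.map π) := by
  have hstar : ∀ x : Matrix (Fin n) (Fin n) A,
      (star x * x).map π = star (x.map π) * x.map π := by
    intro x
    ext i j
    simp [Matrix.mul_apply, Matrix.star_apply, map_star]
  rw [CStarMatrix.nonneg_ofMatrix_iff]
  constructor
  · rintro ⟨x, c, hc, rfl⟩
    rw [hpn.eq_zero_iff hnorm] at hc
    refine ⟨x.map π, ?_⟩
    rw [Matrix.map_add _ (map_add π), hc, add_zero, hstar]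
  · rintro ⟨Y, hY⟩
    let x := Y.map (Function.surjInv hsurj)
    have hx : x.map π = Y := Matrix.ext fun i j => Function.surjInv_eq hsurj _
    refine ⟨x, M - star x * x, ?_, (add_sub_cancel _ _).symm⟩
    rw [hpn.eq_zero_iff hnorm, Matrix.map_sub _ (map_sub π), hstar, hx, hY, sub_self]

theorem forall_seminorm_eq_iff_forall_lamPos_iff
    {A₁ A₂ B₁ B₂ S : Type*} [Ring A₁] [StarRing A₁] [Algebra ℂ A₁]
    [Ring A₂] [StarRing A₂] [Algebra ℂ A₂] [CStarAlgebra B₁] [CStarAlgebra B₂]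
    [AddCommGroup S] [Module ℂ S]
    {p₁ : A₁ → ℝ} {pn₁ : ∀ n : ℕ, Matrix (Fin n) (Fin n) A₁ → ℝ}
    (hpn₁ : IsMatrixCstarSeminormFamily p₁ pn₁)
    {p₂ : A₂ → ℝ} {pn₂ : ∀ n : ℕ, Matrix (Fin n) (Fin n) A₂ → ℝ}
    (hpn₂ : IsMatrixCstarSeminormFamily p₂ pn₂)
    {π₁ : A₁ →⋆ₐ[ℂ] B₁} (hsurj₁ : Function.Surjective π₁) (hnorm₁ : ∀ a, ‖π₁ a‖ = p₁ a)
    {π₂ : A₂ →⋆ₐ[ℂ] B₂} (hsurj₂ : Function.Surjective π₂) (hnorm₂ : ∀ a, ‖π₂ a‖ = p₂ a)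
    (ι₁ : S →ₗ[ℂ] A₁) (ι₂ : S →ₗ[ℂ] A₂) {e : S} (h₁ : ι₁ e = 1) (h₂ : ι₂ e = 1)
    (hstar : ∀ s, ∃ t, ι₁ t = star (ι₁ s)) :
    (∀ (n : ℕ) (M : Matrix (Fin n) (Fin n) S), pn₂ n (M.map ι₂) = pn₁ n (M.map ι₁)) ↔
    ∀ (n : ℕ) (M : Matrix (Fin n) (Fin n) S),
      LamPos pn₁ n (M.map ι₁) ↔ LamPos pn₂ n (M.map ι₂) := by
  let _ := CStarAlgebra.spectralOrder B₁
  have _ := CStarAlgebra.spectralOrderedRing B₁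
  let _ := CStarAlgebra.spectralOrder B₂
  have _ := CStarAlgebra.spectralOrderedRing B₂
  simp only [hpn₁.eq_norm_ofMatrix hsurj₁ hnorm₁, hpn₂.eq_norm_ofMatrix hsurj₂ hnorm₂,
    hpn₁.lamPos_iff hsurj₁ hnorm₁, hpn₂.lamPos_iff hsurj₂ hnorm₂, Matrix.map_map]
  refine forall_norm_eq_iff_forall_nonneg_iff (a₁ := (π₁ : A₁ →ₐ[ℂ] B₁).toLinearMap ∘ₗ ι₁)
    (a₂ := (π₂ : A₂ →ₐ[ℂ] B₂).toLinearMap ∘ₗ ι₂) (e := e) ?_ ?_ fun s => ?_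
  · simp [h₁]
  · simp [h₂]
  · obtain ⟨t, ht⟩ := hstar s
    exact ⟨t, by simp [ht, map_star]⟩

end MatrixSeminorm

/-- a unital linear map `φ : S₁ → S₂` is local completely isometric iff it is a
local isometry and both `φ` and `φ⁻¹ : φ(S₁) → S₁` are admissible local completely positive. -/
theorem stmt10 {Λ : Type*} [Preorder Λ] {A₁ : Type*} [Ring A₁] [StarRing A₁] [Algebra ℂ A₁]
    {A₂ : Type*} [Ring A₂] [StarRing A₂] [Algebra ℂ A₂]
    {B₁ : Λ → Type*} [∀ l, NormedRing (B₁ l)] [∀ l, StarRing (B₁ l)] [∀ l, CStarRing (B₁ l)]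
    [∀ l, NormedAlgebra ℂ (B₁ l)] [∀ l, StarModule ℂ (B₁ l)] [∀ l, CompleteSpace (B₁ l)]
    {B₂ : Λ → Type*} [∀ l, NormedRing (B₂ l)] [∀ l, StarRing (B₂ l)] [∀ l, CStarRing (B₂ l)]
    [∀ l, NormedAlgebra ℂ (B₂ l)] [∀ l, StarModule ℂ (B₂ l)] [∀ l, CompleteSpace (B₂ l)]
    (p₁ : Λ → A₁ → ℝ) (hp₁ : ∀ l, IsCstarSeminorm (p₁ l))
    (hmono₁ : ∀ ⦃l₁ l₂ : Λ⦄, l₁ ≤ l₂ → ∀ a, p₁ l₁ a ≤ p₁ l₂ a)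
    (p₂ : Λ → A₂ → ℝ) (hp₂ : ∀ l, IsCstarSeminorm (p₂ l))
    (hmono₂ : ∀ ⦃l₁ l₂ : Λ⦄, l₁ ≤ l₂ → ∀ a, p₂ l₁ a ≤ p₂ l₂ a)
    (π₁ : ∀ l, A₁ →⋆ₐ[ℂ] B₁ l) (hsurj₁ : ∀ l, Function.Surjective ⇑(π₁ l))
    (hnorm₁ : ∀ l a, ‖(π₁ l) a‖ = p₁ l a)
    (π₂ : ∀ l, A₂ →⋆ₐ[ℂ] B₂ l) (hsurj₂ : ∀ l, Function.Surjective ⇑(π₂ l))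
    (hnorm₂ : ∀ l a, ‖(π₂ l) a‖ = p₂ l a)
    (pn₁ : Λ → ∀ n : ℕ, Matrix (Fin n) (Fin n) A₁ → ℝ)
    (hpn₁ : ∀ l, IsMatrixCstarSeminormFamily (p₁ l) (pn₁ l))
    (pn₂ : Λ → ∀ n : ℕ, Matrix (Fin n) (Fin n) A₂ → ℝ)
    (hpn₂ : ∀ l, IsMatrixCstarSeminormFamily (p₂ l) (pn₂ l))
    (S₁ : Submodule ℂ A₁) (hS₁star : ∀ s ∈ S₁, star s ∈ S₁) (hS₁one : (1 : A₁) ∈ S₁)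
    (S₂ : Submodule ℂ A₂) (hS₂star : ∀ s ∈ S₂, star s ∈ S₂) (hS₂one : (1 : A₂) ∈ S₂)
    (hHaus₁ : ∀ a : A₁, (∀ l, p₁ l a = 0) → a = 0)
    (φ : ↥S₁ →ₗ[ℂ] ↥S₂) (hφ1 : ((φ ⟨1, hS₁one⟩ : ↥S₂) : A₂) = 1) :
    IsLocCompIsometric pn₁ pn₂ S₁ S₂ φ ↔
      ((∀ (l : Λ) (s : ↥S₁), p₂ l ((φ s : ↥S₂) : A₂) = p₁ l (s : A₁)) ∧
       IsAdmLocCP pn₁ pn₂ S₁ S₂ φ ∧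
       ∃ ψ : ↥(Submodule.map S₂.subtype (LinearMap.range φ)) →ₗ[ℂ] ↥S₁,
         (∀ (s : ↥S₁) (t : ↥(Submodule.map S₂.subtype (LinearMap.range φ))),
           (t : A₂) = ((φ s : ↥S₂) : A₂) → ψ t = s) ∧
         IsAdmLocCP pn₂ pn₁ (Submodule.map S₂.subtype (LinearMap.range φ)) S₁ ψ) := by
  have hfam : ∀ l, (∀ (n : ℕ) (M : Matrix (Fin n) (Fin n) ↥S₁),
      pn₂ l n (M.map fun s => ((φ s : ↥S₂) : A₂)) = pn₁ l n (M.map Subtype.val)) ↔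
      ∀ (n : ℕ) (M : Matrix (Fin n) (Fin n) ↥S₁), LamPos (pn₁ l) n (M.map Subtype.val) ↔
        LamPos (pn₂ l) n (M.map fun s => ((φ s : ↥S₂) : A₂)) := by
    intro l
    let _ : CStarAlgebra (B₁ l) := { }
    let _ : CStarAlgebra (B₂ l) := { }
    exact forall_seminorm_eq_iff_forall_lamPos_iff (hpn₁ l) (hpn₂ l) (hsurj₁ l) (hnorm₁ l)
      (hsurj₂ l) (hnorm₂ l) S₁.subtype (S₂.subtype ∘ₗ φ) (e := ⟨1, hS₁one⟩) rfl hφ1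
      fun s => ⟨⟨star (s : A₁), hS₁star _ s.2⟩, rfl⟩
  have hmem : ∀ s : ↥S₁, ((φ s : ↥S₂) : A₂) ∈ Submodule.map S₂.subtype (LinearMap.range φ) :=
    fun s => ⟨φ s, ⟨s, rfl⟩, rfl⟩
  constructor
  · intro h
    have hiso : ∀ (l : Λ) (s : ↥S₁), p₂ l ((φ s : ↥S₂) : A₂) = p₁ l (s : A₁) := fun l s => by
      rw [← (hpn₂ l).one, ← (hpn₁ l).one]
      exact h l 1 fun _ _ => s
    have hpos := fun l => (hfam l).1 (h l)
    refine ⟨hiso, fun l n M => ⟨(hpos l n M).1, fun hM => (h l n M).trans hM⟩, ?_⟩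
    have hinj : Function.Injective (S₂.subtype ∘ₗ φ) := by
      rw [← LinearMap.ker_eq_bot, LinearMap.ker_eq_bot']
      intro s hs
      refine Subtype.ext (hHaus₁ _ fun l => ?_)
      rw [← hiso]
      exact (congrArg (p₂ l) hs).trans (hp₂ l).map_zero'
    let ψ : ↥(Submodule.map S₂.subtype (LinearMap.range φ)) →ₗ[ℂ] ↥S₁ :=
      (LinearEquiv.ofInjective _ hinj).symm.toLinearMap ∘ₗ
        (LinearEquiv.ofEq _ _ (LinearMap.range_comp φ S₂.subtype).symm).toLinearMap
    have hψ : ∀ t, ((φ (ψ t) : ↥S₂) : A₂) = t := fun t =>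
      congrArg Subtype.val ((LinearEquiv.ofInjective _ hinj).apply_symm_apply
        (LinearEquiv.ofEq _ _ (LinearMap.range_comp φ S₂.subtype).symm t))
    refine ⟨ψ, fun s t ht => hinj ((hψ t).trans ht), fun l n M => ?_⟩
    have hM : M.map Subtype.val = (M.map ψ).map fun s => ((φ s : ↥S₂) : A₂) :=
      Matrix.ext fun i j => (hψ (M i j)).symm
    rw [hM]
    exact ⟨(hpos l n (M.map ψ)).2, fun h0 => (h l n (M.map ψ)).symm.trans h0⟩
  · rintro ⟨-, hφ, ψ, hψ, hψcp⟩ l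
    refine (hfam l).2 fun n M => ⟨(hφ l n M).1, fun hM => ?_⟩
    have hMψ : (M.map fun s => (⟨_, hmem s⟩ :
        ↥(Submodule.map S₂.subtype (LinearMap.range φ)))).map (fun t => (ψ t : A₁)) =
        M.map Subtype.val :=
      Matrix.ext fun i j => congrArg Subtype.val (hψ (M i j) ⟨_, hmem _⟩ rfl)
    rw [← hMψ]
    exact (hψcp l n _).1 hM
end

section
/- Let φ : S → B(H) be a unital local completely positive map on a local operator system S ⊆ A. Then there exist λ₀ ∈ Λ and a unital local completely positive map φ̃ : A → B(H) with φ̃|_S = φ and ‖φ̃(a)‖ ≤ p_{λ₀}(a) for all a ∈ A. -/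
open scoped ComplexOrder

theorem exists_star_mul_self_add_eq {B : Type*} [NormedRing B] [StarRing B] [CStarRing B]
    [NormedAlgebra ℂ B] [StarModule ℂ B] [CompleteSpace B] (b : B) :
    ∃ d : B, star b * b + star d * d = ((‖b‖ ^ 2 : ℝ) : ℂ) • (1 : B) := by
  let : CStarAlgebra B := {}
  let := CStarAlgebra.spectralOrder B
  have := CStarAlgebra.spectralOrderedRing B
  have h : 0 ≤ (algebraMap ℝ B) (‖b‖ ^ 2) - star b * b :=
    sub_nonneg.2 CStarAlgebra.star_mul_le_algebraMap_norm_sq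
  obtain ⟨d, hd⟩ := CStarAlgebra.nonneg_iff_eq_star_mul_self.1 h
  refine ⟨d, ?_⟩
  rw [← hd, add_sub_cancel, Algebra.algebraMap_eq_smul_one]
  exact (Complex.coe_smul _ _).symm

/-- A kernel on `X` with values in the linear functionals on `A` is positive on `S` relative to
`π : A → B` if it is nonnegative on `S`-valued matrices whose image in `B` is of the form `x*x`. -/
def IsPosKernel {X A B : Type*} [Ring A] [StarRing A] [Algebra ℂ A] [Ring B] [StarRing B]
    [Algebra ℂ B] (π : A →⋆ₐ[ℂ] B) (S : Submodule ℂ A) (K : X → X → A →ₗ[ℂ] ℂ) : Prop :=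
  ∀ (n m : ℕ) (v : Fin n → X) (M : Fin n → Fin n → A) (x : Fin m → Fin n → B),
    (∀ i j, M i j ∈ S) → (∀ i j, π (M i j) = ∑ k, star (x k i) * x k j) →
    0 ≤ ∑ i, ∑ j, K (v i) (v j) (M i j)

namespace IsPosKernel

theorem diag_nonneg {X A B : Type*} [Ring A] [StarRing A] [Algebra ℂ A] [Ring B] [StarRing B]
    [Algebra ℂ B] {π : A →⋆ₐ[ℂ] B} {S : Submodule ℂ A} {K : X → X → A →ₗ[ℂ] ℂ} (hK : IsPosKernel π S K) (h1 : (1 : A) ∈ S) (ξ : X) : 0 ≤ K ξ ξ 1 := by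
  simpa using hK 1 1 (fun _ => ξ) (fun _ _ => 1) (fun _ _ => 1) (fun _ _ => h1) (by simp)

variable {X A B : Type*} [Ring A] [StarRing A] [Algebra ℂ A] [NormedRing B] [StarRing B]
  [CStarRing B] [NormedAlgebra ℂ B] [StarModule ℂ B] [CompleteSpace B] {π : A →⋆ₐ[ℂ] B}
  {S : Submodule ℂ A} {K : X → X → A →ₗ[ℂ] ℂ}

theorem pair_nonneg (hK : IsPosKernel π S K) (h1 : (1 : A) ∈ S) (ξ η : X) {a a' : A}
    (ha : a ∈ S) (ha' : a' ∈ S) (h : π a' = star (π a)) :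
    0 ≤ K ξ ξ 1 + K ξ η a + K η ξ a' + ((‖π a‖ ^ 2 : ℝ) : ℂ) * K η η 1 := by
  obtain ⟨d, hd⟩ := exists_star_mul_self_add_eq (π a)
  have := hK 2 2 ![ξ, η] ![![1, a], ![a', ((‖π a‖ ^ 2 : ℝ) : ℂ) • 1]] ![![1, π a], ![0, d]]
    (by
      intro i j
      fin_cases i <;> fin_cases j
      exacts [h1, ha, ha', S.smul_mem _ h1])
    (by
      intro i j
      fin_cases i <;> fin_cases j <;> simp [Fin.sum_univ_two, h]
      simpa using hd.symm)
  simpa [Fin.sum_univ_two, add_assoc] using this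

theorem conj_apply (hK : IsPosKernel π S K) (h1 : (1 : A) ∈ S) (ξ η : X) {a a' : A}
    (ha : a ∈ S) (ha' : a' ∈ S) (h : π a' = star (π a)) :
    K η ξ a' = (starRingEnd ℂ) (K ξ η a) := by
  have e1 := hK.pair_nonneg h1 ξ η ha ha' h
  have e2 := hK.pair_nonneg h1 ξ η (S.smul_mem Complex.I ha) (S.smul_mem (-Complex.I) ha')
    (by simp [h, star_smul])
  have e3 := hK.diag_nonneg h1 ξ
  have e4 := hK.diag_nonneg h1 η
  rw [Complex.nonneg_iff] at e1 e2 e3 e4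
  have i1 := e1.2
  have i2 := e2.2
  simp only [Complex.add_im, Complex.mul_im, map_smul, smul_eq_mul, Complex.ofReal_re,
    Complex.ofReal_im, ← e3.2, ← e4.2, Complex.neg_re, Complex.neg_im, Complex.I_re,
    Complex.I_im] at i1 i2
  apply Complex.ext
  · simp only [Complex.conj_re]; linarith
  · simp only [Complex.conj_im]; linarith

theorem conj_symm (hK : IsPosKernel π ⊤ K) (ξ η : X) (a : A) :
    (starRingEnd ℂ) (K η ξ (star a)) = K ξ η a := by
  rw [hK.conj_apply Submodule.mem_top ξ η (a := a) Submodule.mem_top Submodule.mem_top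
    (map_star _ _), Complex.conj_conj]

end IsPosKernel

/-- Kernels whose hermitian part is, modulo the kernel of `π`, of the form `x*x`. -/
def accretiveCone {X A B : Type*} [Ring A] [StarRing A] [Algebra ℂ A] [Ring B] [StarRing B]
    [Algebra ℂ B] [StarModule ℂ B] (π : A →⋆ₐ[ℂ] B) : PointedCone ℝ (X × X →₀ A) where
  carrier := {y | ∃ (m : ℕ) (u : Fin m → X → B), ∀ α β,
    π (y (α, β)) + star (π (y (β, α))) = (2 : ℂ) • ∑ k, star (u k α) * u k β}
  zero_mem' := ⟨0, Fin.elim0, by simp⟩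
  add_mem' := by
    rintro y z ⟨m, u, hu⟩ ⟨n, w, hw⟩
    refine ⟨m + n, Fin.append u w, fun α β => ?_⟩
    simp only [Fin.sum_univ_add, Fin.append_left, Fin.append_right, smul_add, ← hu, ← hw,
      Finsupp.add_apply, map_add, star_add]
    abel
  smul_mem' := by
    rintro ⟨c, hc⟩ y ⟨m, u, hu⟩
    refine ⟨m, fun k α => ((√c : ℝ) : ℂ) • u k α, fun α β => ?_⟩
    have e : ∀ α β, π ((c • y) (α, β)) = (c : ℂ) • π (y (α, β)) := fun α β => by
      rw [← map_smul]; rfl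
    have e' : ((√c : ℝ) : ℂ) * ((√c : ℝ) : ℂ) = (c : ℂ) := by
      rw [← Complex.ofReal_mul, Real.mul_self_sqrt hc]
    have e'' : (⟨c, hc⟩ : {c : ℝ // 0 ≤ c}) • y = c • y := rfl
    rw [e'', e, e]
    simp only [star_smul, smul_mul_smul_comm, RCLike.star_def, Complex.conj_ofReal, e',
      ← Finset.smul_sum]
    rw [smul_comm, ← hu, smul_add]

theorem mem_accretiveCone {X A B : Type*} [Ring A] [StarRing A] [Algebra ℂ A] [Ring B]
    [StarRing B] [Algebra ℂ B] [StarModule ℂ B] {π : A →⋆ₐ[ℂ] B} {y : X × X →₀ A} :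
    y ∈ accretiveCone π ↔ ∃ (m : ℕ) (u : Fin m → X → B), ∀ α β,
      π (y (α, β)) + star (π (y (β, α))) = (2 : ℂ) • ∑ k, star (u k α) * u k β :=
  Iff.rfl

namespace IsPosKernel

/-- The linear functional on finitely supported kernels obtained by pairing with `K`. -/
noncomputable def pairing {X A : Type*} [Ring A] [Algebra ℂ A] (K : X → X → A →ₗ[ℂ] ℂ) : (X × X →₀ A) →ₗ[ℂ] ℂ :=
  Finsupp.lsum ℂ fun q => K q.1 q.2

theorem pairing_apply {X A : Type*} [Ring A] [Algebra ℂ A]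
    (K : X → X → A →ₗ[ℂ] ℂ) (y : X × X →₀ A) :
    pairing K y = y.sum fun q a => K q.1 q.2 a := rfl

variable {X A B : Type*} [Ring A] [StarRing A] [Algebra ℂ A] [NormedRing B] [StarRing B]
  [CStarRing B] [NormedAlgebra ℂ B] [StarModule ℂ B] [CompleteSpace B] {π : A →⋆ₐ[ℂ] B}
  {S : Submodule ℂ A} {K : X → X → A →ₗ[ℂ] ℂ}

theorem re_pairing_nonneg (hK : IsPosKernel π S K) (h1 : (1 : A) ∈ S)
    (hS : ∀ s ∈ S, star s ∈ S) {y : X × X →₀ A} (hy : ∀ q, y q ∈ S)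
    (hC : y ∈ accretiveCone π) : 0 ≤ (pairing K y).re := by
  classical
  obtain ⟨m, u, hu⟩ := mem_accretiveCone.1 hC
  set T : Finset X := y.support.image Prod.fst ∪ y.support.image Prod.snd with hT
  have hsub : y.support ⊆ T ×ˢ T := by
    intro q hq
    simp only [Finset.mem_product, hT, Finset.mem_union, Finset.mem_image]
    exact ⟨Or.inl ⟨q, hq, rfl⟩, Or.inr ⟨q, hq, rfl⟩⟩
  have hsum : pairing K y
      = ∑ i : Fin T.card, ∑ j : Fin T.card, K (T.equivFin.symm i) (T.equivFin.symm j)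
          (y (T.equivFin.symm i, T.equivFin.symm j)) := by
    rw [pairing_apply, Finsupp.sum_of_support_subset _ hsub _ (by simp), Finset.sum_product,
      ← Finset.sum_coe_sort, ← T.equivFin.symm.sum_comp]
    refine Finset.sum_congr rfl fun i _ => ?_
    rw [← Finset.sum_coe_sort, ← T.equivFin.symm.sum_comp]
  set v : Fin T.card → X := fun i => T.equivFin.symm i
  have key := hK _ m v
    (fun i j => (2⁻¹ : ℂ) • (y (v i, v j) + star (y (v j, v i)))) (fun k i => u k (v i))
    (fun i j => S.smul_mem _ (S.add_mem (hy _) (hS _ (hy _))))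
    (fun i j => by
      rw [map_smul, map_add, map_star, hu, inv_smul_smul₀ two_ne_zero])
  have e : ∀ i j, K (v i) (v j) ((2⁻¹ : ℂ) • (y (v i, v j) + star (y (v j, v i))))
      = 2⁻¹ * K (v i) (v j) (y (v i, v j))
        + 2⁻¹ * (starRingEnd ℂ) (K (v j) (v i) (y (v j, v i))) := fun i j => by
    rw [map_smul, map_add, hK.conj_apply h1 (v j) (v i) (hy _) (hS _ (hy _)) (map_star _ _),
      smul_eq_mul, mul_add]
  simp only [e, Finset.sum_add_distrib, ← Finset.mul_sum] at key
  rw [Finset.sum_comm (f := fun i j => (starRingEnd ℂ) (K (v j) (v i) (y (v j, v i))))] at key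
  simp only [← map_sum] at key
  rw [← hsum] at key
  have := (Complex.nonneg_iff.1 key).1
  simp at this
  linarith

theorem exists_add_mem_accretiveCone (h1 : (1 : A) ∈ S)
    (y : X × X →₀ A) :
    ∃ x : X × X →₀ A, (∀ q, x q ∈ S) ∧ x + y ∈ accretiveCone π := by
  classical
  induction y using Finsupp.induction_linear with
  | zero => exact ⟨0, by simp, by simp⟩
  | add f g hf hg =>
    obtain ⟨x, hx, hxf⟩ := hf
    obtain ⟨z, hz, hzg⟩ := hg
    refine ⟨x + z, fun q => S.add_mem (hx q) (hz q), ?_⟩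
    rw [add_add_add_comm]
    exact add_mem hxf hzg
  | single q a =>
    obtain ⟨ξ, η⟩ := q
    obtain ⟨d, hd⟩ := exists_star_mul_self_add_eq (π ((2⁻¹ : ℂ) • a))
    set b := π ((2⁻¹ : ℂ) • a) with hb
    set r : ℂ := ((‖b‖ ^ 2 : ℝ) : ℂ) with hr
    have hrr : star r = r := Complex.conj_ofReal _
    have ha : π a = (2 : ℂ) • b := by
      rw [hb, map_smul, smul_inv_smul₀ two_ne_zero]
    refine ⟨Finsupp.single (ξ, ξ) 1 + Finsupp.single (η, η) (r • 1), fun q => ?_, ?_⟩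
    · rw [Finsupp.add_apply, Finsupp.single_apply, Finsupp.single_apply]
      refine S.add_mem ?_ ?_ <;> split_ifs <;> simp [h1, S.smul_mem]
    · refine mem_accretiveCone.2 ⟨2, ![fun α => (if ξ = α then 1 else 0) + (if η = α then b else 0),
        fun α => if η = α then d else 0], fun α β => ?_⟩
      simp only [Finsupp.add_apply, Finsupp.single_apply, Prod.mk.injEq, Fin.sum_univ_two,
        Matrix.cons_val_zero, Matrix.cons_val_one]
      generalize (ξ = α) = P₁, (η = α) = P₂, (ξ = β) = P₃, (η = β) = P₄
      replace hd := hd.symm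
      clear_value b r
      clear hb hr
      by_cases P₁ <;> by_cases P₂ <;> by_cases P₃ <;> by_cases P₄ <;>
        simp [*, two_smul, add_mul, mul_add, star_add, star_mul] <;> abel

theorem exists_extension (hK : IsPosKernel π S K)
    (h1 : (1 : A) ∈ S) (hS : ∀ s ∈ S, star s ∈ S) :
    ∃ F : X → X → A →ₗ[ℂ] ℂ, IsPosKernel π ⊤ F ∧ ∀ ξ η, ∀ s ∈ S, F ξ η s = K ξ η s := by
  classical
  let D : Submodule ℂ (X × X →₀ A) :=
    { carrier := {y | ∀ q, y q ∈ S}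
      zero_mem' := by simp
      add_mem' := fun hx hy q => S.add_mem (hx q) (hy q)
      smul_mem' := fun c x hx q => S.smul_mem c (hx q) }
  let f : (X × X →₀ A) →ₗ.[ℝ] ℝ :=
    ⟨D.restrictScalars ℝ,
      (Complex.reLm ∘ₗ (pairing K).restrictScalars ℝ).domRestrict (D.restrictScalars ℝ)⟩
  obtain ⟨g, hgf, hg⟩ := riesz_extension (accretiveCone π) f
    (fun y hy => hK.re_pairing_nonneg h1 hS y.2 hy)
    (fun y => by
      obtain ⟨x, hx, hxy⟩ := exists_add_mem_accretiveCone (π := π) h1 y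
      exact ⟨⟨x, hx⟩, hxy⟩)
  have hgD : ∀ y, (∀ q, y q ∈ S) → g y = (pairing K y).re := fun y hy => hgf ⟨y, hy⟩
  let G : (X × X →₀ A) →ₗ[ℂ] ℂ := Module.Dual.extendRCLike g
  have hG : ∀ y, G y = (g y : ℂ) - Complex.I * (g (Complex.I • y) : ℂ) := fun y =>
    Module.Dual.extendRCLike_apply g y
  refine ⟨fun ξ η => G ∘ₗ Finsupp.lsingle (ξ, η), ?_, fun ξ η s hs => ?_⟩
  · intro n m v M x _ hM
    set y : X × X →₀ A := ∑ i, ∑ j, Finsupp.single (v i, v j) (M i j) with hy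
    have hyG : ∑ i, ∑ j, (G ∘ₗ Finsupp.lsingle (v i, v j)) (M i j) = G y := by
      simp [hy]
    rw [hyG]
    set u : Fin m → X → B := fun k α => ∑ i, if v i = α then x k i else 0 with hu
    have hyu : ∀ α β, π (y (α, β)) = ∑ k, star (u k α) * u k β := by
      intro α β
      simp only [hy, hu, Finsupp.finsetSum_apply, Finsupp.single_apply, map_sum, star_sum,
        Finset.sum_mul_sum]
      rw [Finset.sum_comm' (t' := Finset.univ) (s' := fun _ => Finset.univ) (by simp)]
      rw [Finset.sum_comm]
      rw [Finset.sum_comm (s := (Finset.univ : Finset (Fin m)))]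
      refine Finset.sum_congr rfl fun i _ => ?_
      rw [Finset.sum_comm (s := (Finset.univ : Finset (Fin m)))]
      refine Finset.sum_congr rfl fun j _ => ?_
      by_cases hi : v i = α <;> by_cases hj : v j = β <;> simp [hi, hj, hM]
    have hsym : ∀ α β, star (π (y (β, α))) = π (y (α, β)) := by
      intro α β
      simp [hyu, star_sum]
    have p1 : 0 ≤ g y := hg _ (mem_accretiveCone.2 ⟨m, u, fun α β => by
      rw [hsym, two_smul, hyu]⟩)
    have p2 : ∀ c : ℂ, star c = -c → 0 ≤ g (c • y) := fun c hc =>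
      hg _ (mem_accretiveCone.2 ⟨0, Fin.elim0, fun α β => by
        simp [Finsupp.smul_apply, map_smul, star_smul, hsym, hc]⟩)
    have p3 := p2 Complex.I (by simp)
    have p4 := p2 (-Complex.I) (by simp)
    rw [neg_smul, map_neg] at p4
    have p5 : g (Complex.I • y) = 0 := by linarith
    rw [hG, p5]
    simpa using p1
  · have hs' : ∀ c : ℂ, ∀ q, (c • Finsupp.single (ξ, η) s) q ∈ S := fun c q => by
      rw [Finsupp.smul_apply, Finsupp.single_apply]
      split_ifs
      exacts [S.smul_mem _ hs, S.smul_mem _ S.zero_mem]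
    have e1 : pairing K (Finsupp.single (ξ, η) s) = K ξ η s := by
      simp [pairing_apply]
    have h1 := hs' 1
    rw [one_smul] at h1
    rw [LinearMap.comp_apply, Finsupp.lsingle_apply, hG, hgD _ h1, hgD _ (hs' _), map_smul, e1]
    apply Complex.ext <;> simp

end IsPosKernel

section HilbertSpace

variable {H : Type*} [NormedAddCommGroup H] [InnerProductSpace ℂ H]

namespace IsPosKernel

variable {A B : Type*} [Ring A] [StarRing A] [Algebra ℂ A] [NormedRing B] [StarRing B]
  [CStarRing B] [NormedAlgebra ℂ B] [StarModule ℂ B] [CompleteSpace B] {π : A →⋆ₐ[ℂ] B}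
  {K : H → H → A →ₗ[ℂ] ℂ}

theorem quadratic_nonneg (hK : IsPosKernel π ⊤ K) (h1 : ∀ ξ η, K ξ η 1 = inner ℂ ξ η)
    {m : ℕ} (ξ : H) (z : ℂ) (η : Fin m → H) (r : Fin m → ℂ) (a : A) :
    0 ≤ ‖z‖ ^ 2 * ‖ξ‖ ^ 2 + 2 * ((starRingEnd ℂ) z * ∑ j, r j * K ξ (η j) a).re
      + ‖π a‖ ^ 2 * ‖∑ j, r j • η j‖ ^ 2 := by
  obtain ⟨d, hd⟩ := exists_star_mul_self_add_eq (π a)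
  set R : ℂ := ((‖π a‖ ^ 2 : ℝ) : ℂ) with hR
  have key := hK (m + 1) 2 (Fin.cons ξ η)
    (Fin.cons (Fin.cons (((starRingEnd ℂ) z * z) • 1) fun j => ((starRingEnd ℂ) z * r j) • a)
      fun i => Fin.cons (((starRingEnd ℂ) (r i) * z) • star a)
        fun j => ((starRingEnd ℂ) (r i) * r j * R) • 1)
    ![Fin.cons (z • 1) fun j => r j • π a, Fin.cons 0 fun j => r j • d]
    (fun _ _ => Submodule.mem_top)
    (by
      intro i j
      refine Fin.cases ?_ (fun i => ?_) i <;> refine Fin.cases ?_ (fun j => ?_) j <;>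
        simp [Fin.sum_univ_two, star_smul, map_star, smul_smul, mul_comm]
      rw [← smul_add, hd, smul_smul, mul_comm])
  have hstar : ∀ i, K (η i) ξ (star a) = (starRingEnd ℂ) (K ξ (η i) a) := fun i =>
    hK.conj_apply Submodule.mem_top ξ (η i) Submodule.mem_top Submodule.mem_top (map_star _ _)
  simp only [Fin.sum_univ_succ, Fin.cons_zero, Fin.cons_succ, map_smul, h1, hstar,
    smul_eq_mul, Finset.sum_add_distrib] at key
  set Z := ∑ j, r j * K ξ (η j) a with hZ
  have t1 : ∑ j, (starRingEnd ℂ) z * r j * K ξ (η j) a = (starRingEnd ℂ) z * Z := by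
    rw [hZ, Finset.mul_sum]; exact Finset.sum_congr rfl fun _ _ => by ring
  have t2 : ∑ j, (starRingEnd ℂ) (r j) * z * (starRingEnd ℂ) (K ξ (η j) a)
      = (starRingEnd ℂ) ((starRingEnd ℂ) z * Z) := by
    rw [hZ, map_mul, map_sum, Finset.mul_sum]
    exact Finset.sum_congr rfl fun _ _ => by simp; ring
  have t3 : ∑ i, ∑ j, (starRingEnd ℂ) (r i) * r j * R * inner ℂ (η i) (η j)
      = R * ((‖∑ j, r j • η j‖ ^ 2 : ℝ) : ℂ) := by
    rw [Complex.ofReal_pow]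
    change _ = R * ((RCLike.ofReal ‖∑ j, r j • η j‖ : ℂ) ^ 2)
    rw [← inner_self_eq_norm_sq_to_K (𝕜 := ℂ)]
    simp only [sum_inner, inner_sum, inner_smul_left, inner_smul_right, Finset.mul_sum]
    rw [Finset.sum_comm]
    exact Finset.sum_congr rfl fun _ _ => Finset.sum_congr rfl fun _ _ => by ring
  have t4 : (starRingEnd ℂ) z * z * inner ℂ ξ ξ = ((‖z‖ ^ 2 * ‖ξ‖ ^ 2 : ℝ) : ℂ) := by
    rw [inner_self_eq_norm_sq_to_K, mul_comm ((starRingEnd ℂ) z), Complex.mul_conj,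
      Complex.normSq_eq_norm_sq]
    simp
  rw [t1, t2, t3, t4] at key
  have := (Complex.nonneg_iff.1 key).1
  rw [hR, ← Complex.ofReal_mul] at this
  simp only [Complex.add_re, Complex.ofReal_re, Complex.conj_re] at this
  linarith

theorem norm_sum_le (hK : IsPosKernel π ⊤ K) (h1 : ∀ ξ η, K ξ η 1 = inner ℂ ξ η)
    {m : ℕ} (ξ : H) (η : Fin m → H) (r : Fin m → ℂ) (a : A) :
    ‖∑ j, r j * K ξ (η j) a‖ ≤ ‖π a‖ * ‖ξ‖ * ‖∑ j, r j • η j‖ := by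
  set Z := ∑ j, r j * K ξ (η j) a with hZ
  set Q := ‖∑ j, r j • η j‖ with hQ
  have hquad : ∀ t : ℝ, 0 ≤ (‖Z‖ ^ 2 * ‖ξ‖ ^ 2) * (t * t) + (2 * ‖Z‖ ^ 2) * t
      + ‖π a‖ ^ 2 * Q ^ 2 := fun t => by
    have := hK.quadratic_nonneg h1 ξ (t * Z) η r a
    rw [← hZ, ← hQ, map_mul, Complex.conj_ofReal, mul_assoc, mul_comm ((starRingEnd ℂ) Z),
      Complex.mul_conj, ← Complex.ofReal_mul, Complex.ofReal_re, Complex.normSq_eq_norm_sq,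
      norm_mul, mul_pow, Complex.norm_real, Real.norm_eq_abs, sq_abs] at this
    linarith
  have hd := discrim_le_zero hquad
  rw [discrim] at hd
  rcases (norm_nonneg Z).eq_or_lt with h0 | h0
  · rw [← h0]; positivity
  · have h2 : 0 < ‖Z‖ ^ 2 := by positivity
    refine le_of_sq_le_sq ?_ (by positivity)
    refine le_of_mul_le_mul_left ?_ h2
    nlinarith

theorem norm_apply_le (hK : IsPosKernel π ⊤ K) (h1 : ∀ ξ η, K ξ η 1 = inner ℂ ξ η)
    (ξ η : H) (a : A) : ‖K ξ η a‖ ≤ ‖π a‖ * ‖ξ‖ * ‖η‖ := by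
  simpa using hK.norm_sum_le h1 ξ ![η] ![1] a

theorem add_right (hK : IsPosKernel π ⊤ K) (h1 : ∀ ξ η, K ξ η 1 = inner ℂ ξ η)
    (ξ η η' : H) (a : A) : K ξ (η + η') a = K ξ η a + K ξ η' a := by
  have := hK.norm_sum_le h1 ξ ![η + η', η, η'] ![1, -1, -1] a
  simp [Fin.sum_univ_three] at this
  linear_combination this

theorem smul_right (hK : IsPosKernel π ⊤ K) (h1 : ∀ ξ η, K ξ η 1 = inner ℂ ξ η)
    (ξ η : H) (c : ℂ) (a : A) : K ξ (c • η) a = c * K ξ η a := by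
  have := hK.norm_sum_le h1 ξ ![c • η, η] ![1, -c] a
  simp [Fin.sum_univ_two] at this
  linear_combination this

theorem exists_operator [CompleteSpace H] (hK : IsPosKernel π ⊤ K)
    (h1 : ∀ ξ η, K ξ η 1 = inner ℂ ξ η) (a : A) :
    ∃ T : H →L[ℂ] H, ‖T‖ ≤ ‖π a‖ ∧ ∀ ξ η, inner ℂ ξ (T η) = K ξ η a := by
  let b : H →ₗ⋆[ℂ] H →ₗ[ℂ] ℂ := LinearMap.mk₂'ₛₗ (starRingEnd ℂ) (RingHom.id ℂ)
    (fun ξ η => K ξ η a)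
    (fun ξ ξ' η => by
      rw [← hK.conj_symm, hK.add_right h1, map_add, hK.conj_symm, hK.conj_symm])
    (fun c ξ η => by
      rw [← hK.conj_symm, hK.smul_right h1, map_mul, hK.conj_symm, smul_eq_mul])
    (fun ξ η η' => hK.add_right h1 ξ η η' a)
    (fun c ξ η => hK.smul_right h1 ξ η c a)
  let T := ContinuousLinearMap.adjoint (InnerProductSpace.continuousLinearMapOfBilin
    (b.mkContinuous₂ ‖π a‖ fun ξ η => hK.norm_apply_le h1 ξ η a))
  have hT : ∀ ξ η, inner ℂ ξ (T η) = K ξ η a := fun ξ η => by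
    rw [ContinuousLinearMap.adjoint_inner_right,
      InnerProductSpace.continuousLinearMapOfBilin_apply]
    rfl
  refine ⟨T, ContinuousLinearMap.opNorm_le_bound _ (norm_nonneg _) fun η => ?_, hT⟩
  have h := hK.norm_apply_le h1 (T η) η a
  rw [← hT, inner_self_eq_norm_sq_to_K] at h
  rcases (norm_nonneg (T η)).eq_or_lt with h0 | h0
  · rw [← h0]; positivity
  · refine le_of_mul_le_mul_left ?_ h0
    simp at h
    nlinarith

theorem exists_linearMap [CompleteSpace H] (hK : IsPosKernel π ⊤ K)
    (h1 : ∀ ξ η, K ξ η 1 = inner ℂ ξ η) :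
    ∃ ψ : A →ₗ[ℂ] (H →L[ℂ] H), (∀ a, ‖ψ a‖ ≤ ‖π a‖) ∧
      ∀ a ξ η, inner ℂ ξ (ψ a η) = K ξ η a := by
  choose T hTn hT using hK.exists_operator h1
  refine ⟨⟨⟨T, fun a b => ?_⟩, fun c a => ?_⟩, hTn, hT⟩
  · ext η
    refine ext_inner_left ℂ fun ξ => ?_
    simp [inner_add_right, hT]
  · ext η
    refine ext_inner_left ℂ fun ξ => ?_
    simp [inner_smul_right, hT]

end IsPosKernel

theorem MatPosOp.sum_inner_nonneg [CompleteSpace H] {n : ℕ}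
    {T : Matrix (Fin n) (Fin n) (H →L[ℂ] H)} (hT : MatPosOp T) (v : Fin n → H) :
    0 ≤ ∑ i, ∑ j, inner ℂ (v i) (T i j (v j)) := by
  obtain ⟨X, rfl⟩ := hT
  have e : ∑ i, ∑ j, inner ℂ (v i) ((star X * X) i j (v j))
      = ∑ k, inner ℂ (∑ i, X k i (v i)) (∑ j, X k j (v j)) := by
    simp only [Matrix.mul_apply, Matrix.star_apply, sum_apply, inner_sum,
      sum_inner, mul_apply_eq_comp, ContinuousLinearMap.star_eq_adjoint,
      ContinuousLinearMap.adjoint_inner_right]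
    rw [Finset.sum_comm]
    conv_lhs => enter [2, j]; rw [Finset.sum_comm]
    rw [Finset.sum_comm]
  rw [e]
  exact Finset.sum_nonneg fun k _ => by
    rw [inner_self_eq_norm_sq_to_K]
    rw [← RCLike.ofReal_pow]
    exact Complex.zero_le_real.2 (sq_nonneg ‖∑ i, X k i (v i)‖)

theorem exists_eq_star_mul_self_of_nonneg [CompleteSpace H] {T : H →L[ℂ] H} (hT : 0 ≤ T) :
    ∃ R : H →L[ℂ] H, T = star R * R :=
  CStarAlgebra.nonneg_iff_eq_star_mul_self.1 hT

theorem matOp_apply {n : ℕ} (T : Matrix (Fin n) (Fin n) (H →L[ℂ] H))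
    (x : PiLp 2 fun _ : Fin n => H) (i : Fin n) : matOp T x i = ∑ j, T i j (x j) := by
  simp [matOp]

theorem matPosOp_of_sum_inner_nonneg [CompleteSpace H] {n : ℕ}
    {T : Matrix (Fin n) (Fin n) (H →L[ℂ] H)}
    (hT : ∀ v : Fin n → H, 0 ≤ ∑ i, ∑ j, inner ℂ (v i) (T i j (v j))) : MatPosOp T := by
  have hinner : ∀ x y : PiLp 2 fun _ : Fin n => H,
      inner ℂ x (matOp T y) = ∑ i, ∑ j, inner ℂ (x i) (T i j (y j)) := fun x y => by
    simp [PiLp.inner_apply, matOp_apply, inner_sum]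
  have hpos : 0 ≤ matOp T := by
    rw [ContinuousLinearMap.nonneg_iff_isPositive, ContinuousLinearMap.isPositive_iff_complex]
    intro x
    have h := hT x
    rw [← hinner, Complex.nonneg_iff] at h
    have e : inner ℂ (matOp T x) x = inner ℂ x (matOp T x) := by
      rw [← inner_conj_symm]
      exact Complex.conj_eq_iff_im.2 h.2.symm
    rw [e]
    refine ⟨Complex.ext rfl ?_, h.1⟩
    exact h.2
  obtain ⟨R, hR⟩ := exists_eq_star_mul_self_of_nonneg hpos
  let inc : Fin n → H →L[ℂ] PiLp 2 fun _ : Fin n => H := fun j =>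
    ((PiLp.continuousLinearEquiv 2 ℂ (fun _ : Fin n => H)).symm :
      ((_ : Fin n) → H) →L[ℂ] PiLp 2 (fun _ : Fin n => H)) ∘L
      ContinuousLinearMap.single ℂ (fun _ : Fin n => H) j
  have hinc : ∀ j v i, inc j v i = if i = j then v else 0 := fun j v i => by
    simp [inc]
  refine ⟨Matrix.of fun i j => PiLp.proj 2 (fun _ : Fin n => H) i ∘L R ∘L inc j, ?_⟩
  ext i j w
  refine ext_inner_left ℂ fun v => ?_
  have e1 : inner ℂ v (T i j w) = inner ℂ (inc i v) (matOp T (inc j w)) := by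
    rw [hinner, Finset.sum_eq_single i, Finset.sum_eq_single j] <;>
      simp +contextual [hinc]
  rw [e1, hR, mul_apply_eq_comp, ContinuousLinearMap.star_eq_adjoint,
    ContinuousLinearMap.adjoint_inner_right, PiLp.inner_apply, Matrix.mul_apply,
    sum_apply, inner_sum]
  refine Finset.sum_congr rfl fun k _ => ?_
  rw [mul_apply_eq_comp, Matrix.star_apply, ContinuousLinearMap.star_eq_adjoint,
    ContinuousLinearMap.adjoint_inner_right]
  rfl

end HilbertSpace

section LocalCP

variable {A H : Type*} [Ring A] [Algebra ℂ A] [NormedAddCommGroup H]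
  [InnerProductSpace ℂ H]

/-- The matrix coefficients of an operator-valued linear map, as a kernel on `H`. -/
noncomputable def innerKernel (φ : A →ₗ[ℂ] (H →L[ℂ] H)) (ξ η : H) : A →ₗ[ℂ] ℂ where
  toFun a := inner ℂ ξ (φ a η)
  map_add' a b := by simp
  map_smul' c a := by simp

theorem innerKernel_apply (φ : A →ₗ[ℂ] (H →L[ℂ] H)) (ξ η : H) (a : A) :
    innerKernel φ ξ η a = inner ℂ ξ (φ a η) := rfl

variable [StarRing A] {B : Type*} [NormedRing B] [StarRing B] [NormedAlgebra ℂ B] [CompleteSpace H]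
  {p : A → ℝ} {pn : ∀ n : ℕ, Matrix (Fin n) (Fin n) A → ℝ} {π : A →⋆ₐ[ℂ] B}

theorem IsLamCPmapOn.isPosKernel (hsurj : Function.Surjective π) (hnorm : ∀ a, ‖π a‖ = p a)
    (hpn : IsMatrixCstarSeminormFamily p pn) {S : Submodule ℂ A} {φ : S →ₗ[ℂ] (H →L[ℂ] H)}
    (hφ : IsLamCPmapOn pn S φ) {φ' : A →ₗ[ℂ] (H →L[ℂ] H)} (hφ' : ∀ s : S, φ' s = φ s) :
    IsPosKernel π S (innerKernel φ') := by
  intro n m v M x hMS hM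
  choose y hy using fun k i => hsurj (x k i)
  let e : Fin n ⊕ Fin m ≃ Fin (n + m) := finSumFinEquiv
  let P : Matrix (Fin n ⊕ Fin m) (Fin n ⊕ Fin m) A := Matrix.fromBlocks (Matrix.of M) 0 0 0
  let Q : Matrix (Fin n ⊕ Fin m) (Fin n ⊕ Fin m) A := Matrix.fromBlocks 0 0 (Matrix.of y) 0
  have hP : ∀ i j, P i j ∈ S := by
    rintro (i | i) (j | j) <;> simp [P, hMS]
  let M' : Matrix (Fin (n + m)) (Fin (n + m)) S :=
    Matrix.of fun i j => ⟨P (e.symm i) (e.symm j), hP _ _⟩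
  let x' := Q.submatrix e.symm e.symm
  have hpos : LamPos pn (n + m) (M'.map Subtype.val) := by
    refine ⟨x', M'.map Subtype.val - star x' * x', ?_, by abel⟩
    rw [hpn.ker]
    intro i j
    obtain ⟨i, rfl⟩ := e.surjective i
    obtain ⟨j, rfl⟩ := e.surjective j
    rw [← hnorm, norm_eq_zero, Matrix.sub_apply, Matrix.mul_apply, ← e.sum_comp, map_sub,
      sub_eq_zero]
    rcases i with i | i <;> rcases j with j | j <;>
      simp [M', x', P, Q, Matrix.star_apply, hM, hy, map_star]
  have key := (hφ.1 _ M' hpos).sum_inner_nonneg fun i => Sum.elim v 0 (e.symm i)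
  simp only [← e.sum_comp, Matrix.map_apply, ← hφ'] at key
  simpa [M', P, innerKernel_apply] using key

theorem IsPosKernel.isLamCPmap (hnorm : ∀ a, ‖π a‖ = p a)
    (hpn : IsMatrixCstarSeminormFamily p pn) {ψ : A →ₗ[ℂ] (H →L[ℂ] H)}
    (hψ : IsPosKernel π ⊤ (innerKernel ψ)) (hle : ∀ a, ‖ψ a‖ ≤ p a) : IsLamCPmap pn ψ := by
  constructor
  · rintro n _ ⟨x, c, hc, rfl⟩
    refine matPosOp_of_sum_inner_nonneg fun v => ?_
    refine hψ n n v (star x * x + c) (fun k i => π (x k i)) (fun _ _ => Submodule.mem_top) ?_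
    intro i j
    have h0 : π (c i j) = 0 := by
      rw [← norm_eq_zero, hnorm]
      exact (hpn.ker n c).1 hc i j
    simp [Matrix.add_apply, Matrix.mul_apply, Matrix.star_apply, h0, map_star]
  · intro n M hM
    ext1 i j
    have h := hle (M i j)
    rw [(hpn.ker n M).1 hM i j] at h
    exact norm_le_zero_iff.1 h

end LocalCP

/-- every unital local completely positive map `φ : S → B(H)` extends to a
unital local completely positive map `φ̃ : A → B(H)` with `‖φ̃ a‖ ≤ p_{λ₀} a`. -/
theorem stmt12 {Λ : Type*} [Preorder Λ] {A : Type*} [Ring A] [StarRing A] [Algebra ℂ A]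
    {B : Λ → Type*} [∀ l, NormedRing (B l)] [∀ l, StarRing (B l)] [∀ l, CStarRing (B l)]
    [∀ l, NormedAlgebra ℂ (B l)] [∀ l, StarModule ℂ (B l)] [∀ l, CompleteSpace (B l)]
    (p : Λ → A → ℝ) (hp : ∀ l, IsCstarSeminorm (p l))
    (hmono : ∀ ⦃l₁ l₂ : Λ⦄, l₁ ≤ l₂ → ∀ a, p l₁ a ≤ p l₂ a)
    (π : ∀ l, A →⋆ₐ[ℂ] B l) (hsurj : ∀ l, Function.Surjective ⇑(π l))
    (hnorm : ∀ l a, ‖(π l) a‖ = p l a)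
    (pn : Λ → ∀ n : ℕ, Matrix (Fin n) (Fin n) A → ℝ)
    (hpn : ∀ l, IsMatrixCstarSeminormFamily (p l) (pn l))
    (S : Submodule ℂ A) (hSstar : ∀ s ∈ S, star s ∈ S) (hSone : (1 : A) ∈ S)
    {H : Type*} [NormedAddCommGroup H] [InnerProductSpace ℂ H] [CompleteSpace H]
    (φ : ↥S →ₗ[ℂ] (H →L[ℂ] H)) (hφ1 : φ ⟨1, hSone⟩ = 1)
    (hφ : ∃ l : Λ, IsLamCPmapOn (pn l) S φ) :
    ∃ (l₀ : Λ) (ψ : A →ₗ[ℂ] (H →L[ℂ] H)),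
      ψ 1 = 1 ∧ IsLamCPmap (pn l₀) ψ ∧ (∀ s : ↥S, ψ (s : A) = φ s) ∧
      ∀ a : A, ‖ψ a‖ ≤ p l₀ a := by
  obtain ⟨l, hl⟩ := hφ
  obtain ⟨φ', hφ'⟩ := LinearMap.exists_extend φ
  have hφS : ∀ s : S, φ' s = φ s := fun s => LinearMap.congr_fun hφ' s
  obtain ⟨K, hK, hKS⟩ := (hl.isPosKernel (hsurj l) (hnorm l) (hpn l) hφS).exists_extension
    hSone hSstar
  have h1 : ∀ ξ η, K ξ η 1 = inner ℂ ξ η := fun ξ η => by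
    rw [hKS ξ η 1 hSone]
    change inner ℂ ξ (φ' 1 η) = _
    rw [hφS ⟨1, hSone⟩, hφ1]
    rfl
  obtain ⟨ψ, hψn, hψ⟩ := hK.exists_linearMap h1
  have hψK : innerKernel ψ = K := by
    ext ξ η a
    exact hψ a ξ η
  have hψS : ∀ s : S, ψ s = φ s := fun s => by
    ext η
    refine ext_inner_left ℂ fun ξ => ?_
    rw [hψ, hKS ξ η s s.2, ← hφS]
    rfl
  have hle : ∀ a, ‖ψ a‖ ≤ p l a := fun a => (hψn a).trans_eq (hnorm l a)
  exact ⟨l, ψ, (hψS ⟨1, hSone⟩).trans hφ1,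
    IsPosKernel.isLamCPmap (hnorm l) (hpn l) (hψK ▸ hK) hle, hψS, hle⟩
end
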